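/- For q ≥ 2 and any bipartite density matrix ρ_AB, the triangle inequality |F_q(ρ_A) - F_q(ρ_B)| ≤ F_q(ρ_AB) holds, where F_q(ρ) = 1 - Tr(ρ^q). -/

import Mathlib

open scoped BigOperators ComplexOrder

/-- `Tr(ρ^q)` for a Hermitian matrix `ρ`, defined via its spectral decomposition. -/
noncomputable def traceRpow {m : Type*} [Fintype m] [DecidableEq m]
    (ρ : Matrix m m ℂ) (h : ρ.IsHermitian) (q : ℝ) : ℝ :=
  ∑ i, (h.eigenvalues i) ^ q

/-- `F_q(ρ) = 1 - Tr(ρ^q)`. -/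
noncomputable def FqEnt {m : Type*} [Fintype m] [DecidableEq m]
    (ρ : Matrix m m ℂ) (h : ρ.IsHermitian) (q : ℝ) : ℝ :=
  1 - traceRpow ρ h q

theorem Matrix.IsHermitian.traceRpow_eq_sum_roots {m : Type*} [Fintype m] [DecidableEq m]
    {ρ : Matrix m m ℂ} (h : ρ.IsHermitian) (q : ℝ) :
    traceRpow ρ h q = (ρ.charpoly.roots.map fun z : ℂ => z.re ^ q).sum := by
  rw [h.roots_charpoly_eq_eigenvalues, Multiset.map_map]
  rfl

theorem traceRpow_eq_of_charpoly_eq {m n : Type*} [Fintype m] [DecidableEq m]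
    [Fintype n] [DecidableEq n] {ρ : Matrix m m ℂ} {σ : Matrix n n ℂ}
    (hρ : ρ.IsHermitian) (hσ : σ.IsHermitian) (h : ρ.charpoly = σ.charpoly) (q : ℝ) :
    traceRpow ρ hρ q = traceRpow σ hσ q := by
  rw [hρ.traceRpow_eq_sum_roots, hσ.traceRpow_eq_sum_roots, h]

/-- `M * N` and `N * M` have the same nonzero spectrum. -/
theorem traceRpow_mul_comm {m n : Type*} [Fintype m] [DecidableEq m]
    [Fintype n] [DecidableEq n] (M : Matrix m n ℂ) (N : Matrix n m ℂ)
    (hMN : (M * N).IsHermitian) (hNM : (N * M).IsHermitian) {q : ℝ} (hq : q ≠ 0) :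
    traceRpow (M * N) hMN q = traceRpow (N * M) hNM q := by
  have key (p : Polynomial ℂ) (hp : p ≠ 0) (k : ℕ) :
      ((Polynomial.X ^ k * p).roots.map fun z : ℂ => z.re ^ q).sum
        = (p.roots.map fun z : ℂ => z.re ^ q).sum := by
    rw [Polynomial.roots_mul (mul_ne_zero (pow_ne_zero _ Polynomial.X_ne_zero) hp)]
    simp [Multiset.map_nsmul, Multiset.sum_nsmul, Real.zero_rpow hq]
  rw [hMN.traceRpow_eq_sum_roots, hNM.traceRpow_eq_sum_roots,
    ← key _ (Matrix.charpoly_monic _).ne_zero (Fintype.card n), Matrix.charpoly_mul_comm',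
    key _ (Matrix.charpoly_monic _).ne_zero]

/-- The Peierls inequality: the diagonal of a positive semidefinite matrix in any orthonormal basis
has smaller power sums than its spectrum. -/
theorem sum_diag_rpow_le_traceRpow {m : Type*} [Fintype m] [DecidableEq m]
    {σ : Matrix m m ℂ} (hσ : σ.PosSemidef) (W : Matrix.unitaryGroup m ℂ) {q : ℝ} (hq : 1 ≤ q) :
    ∑ k, ((star (W : Matrix m m ℂ) * σ * W) k k).re ^ q ≤ traceRpow σ hσ.1 q := by
  set e := hσ.1.eigenvalues
  let V : Matrix.unitaryGroup m ℂ := star W * hσ.1.eigenvectorUnitary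
  have hV : star (W : Matrix m m ℂ) * σ * W
      = V * Matrix.diagonal (fun i => (e i : ℂ)) * star (V : Matrix m m ℂ) := by
    conv_lhs => rw [hσ.1.spectral_theorem]
    simp only [Unitary.conjStarAlgAut_apply, V, Submonoid.coe_mul, Unitary.coe_star, star_mul,
      star_star, mul_assoc]
    rfl
  have hdiag (k : m) : ((star (W : Matrix m m ℂ) * σ * W) k k).re
      = ∑ i, Complex.normSq (V.1 k i) * e i := by
    rw [hV, Matrix.mul_apply, Complex.re_sum]
    refine Finset.sum_congr rfl fun i _ => ?_
    rw [Matrix.mul_diagonal, Matrix.star_apply, mul_right_comm, Complex.star_def,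
      Complex.mul_conj, ← Complex.ofReal_mul, Complex.ofReal_re]
  have hrow (k : m) : ∑ i, Complex.normSq (V.1 k i) = 1 := by
    have h : (V.1 * star V.1) k k = 1 := by
      rw [Matrix.mem_unitaryGroup_iff.1 V.2, Matrix.one_apply_eq]
    rw [Matrix.mul_apply] at h
    simp only [Matrix.star_apply, Complex.star_def, Complex.mul_conj] at h
    exact_mod_cast h
  have hcol (i : m) : ∑ k, Complex.normSq (V.1 k i) = 1 := by
    have h : (star V.1 * V.1) i i = 1 := by
      rw [Matrix.mem_unitaryGroup_iff'.1 V.2, Matrix.one_apply_eq]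
    rw [Matrix.mul_apply] at h
    simp only [Matrix.star_apply, Complex.star_def, mul_comm _ (V.1 _ i), Complex.mul_conj] at h
    exact_mod_cast h
  calc ∑ k, ((star (W : Matrix m m ℂ) * σ * W) k k).re ^ q
      ≤ ∑ k, ∑ i, Complex.normSq (V.1 k i) * e i ^ q := by
        refine Finset.sum_le_sum fun k _ => ?_
        rw [hdiag]
        exact Real.rpow_arith_mean_le_arith_mean_rpow _ _ _ (fun i _ => Complex.normSq_nonneg _)
          (hrow k) (fun i _ => hσ.eigenvalues_nonneg i) hq
    _ = traceRpow σ hσ.1 q := by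
        rw [Finset.sum_comm]
        simp only [← Finset.sum_mul, hcol, one_mul]
        rfl

/-- Subadditivity of the Tsallis entropy of a probability distribution on a product. -/
theorem sum_marginal_rpow_le {ι κ : Type*} [Fintype ι] [Fintype κ] {p : ι → κ → ℝ}
    (hp : ∀ i j, 0 ≤ p i j) (hsum : ∑ i, ∑ j, p i j = 1) {q : ℝ} (hq : 1 ≤ q) :
    ∑ i, (∑ j, p i j) ^ q + ∑ j, (∑ i, p i j) ^ q ≤ 1 + ∑ i, ∑ j, p i j ^ q := by
  set l : ι → ℝ := fun i => ∑ j, p i j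
  have hl0 (i : ι) : 0 ≤ l i := Finset.sum_nonneg fun j _ => hp i j
  have hpl (i : ι) (j : κ) : p i j ≤ l i :=
    Finset.single_le_sum (fun j _ => hp i j) (Finset.mem_univ j)
  have hl1 (i : ι) : l i ≤ 1 :=
    hsum ▸ Finset.single_le_sum (fun i _ => hl0 i) (Finset.mem_univ i)
  have hmul (i : ι) (j : κ) : l i * (p i j / l i) = p i j := by
    rcases eq_or_ne (l i) 0 with h | h
    · rw [h, zero_mul]
      exact le_antisymm (hp i j) (h ▸ hpl i j)
    · exact mul_div_cancel₀ _ h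
  have hr0 (i : ι) (j : κ) : 0 ≤ p i j / l i := div_nonneg (hp i j) (hl0 i)
  have hr1 (i : ι) : ∑ j, (p i j / l i) ^ q ≤ 1 := by
    calc ∑ j, (p i j / l i) ^ q ≤ ∑ j, p i j / l i :=
          Finset.sum_le_sum fun j _ => Real.rpow_le_self_of_le_one (hr0 i j)
            (div_le_one_of_le₀ (hpl i j) (hl0 i)) hq
      _ = l i / l i := by rw [← Finset.sum_div]
      _ ≤ 1 := div_self_le_one _
  have hjensen : ∑ j, (∑ i, p i j) ^ q ≤ ∑ i, l i * ∑ j, (p i j / l i) ^ q := by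
    simp only [Finset.mul_sum]
    rw [Finset.sum_comm (s := Finset.univ (α := ι))]
    refine Finset.sum_le_sum fun j _ => ?_
    simpa only [hmul] using Real.rpow_arith_mean_le_arith_mean_rpow Finset.univ l
      (fun i => p i j / l i) (fun i _ => hl0 i) hsum (fun i _ => hr0 i j) hq
  have hterm (i : ι) :
      l i ^ q + l i * ∑ j, (p i j / l i) ^ q ≤ l i + ∑ j, p i j ^ q := by
    have h1 : ∑ j, p i j ^ q = l i ^ q * ∑ j, (p i j / l i) ^ q := by
      rw [Finset.mul_sum]
      refine Finset.sum_congr rfl fun j _ => ?_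
      rw [← Real.mul_rpow (hl0 i) (hr0 i j), hmul]
    have h2 : l i ^ q ≤ l i := Real.rpow_le_self_of_le_one (hl0 i) (hl1 i) hq
    rw [h1]
    nlinarith [mul_nonneg (sub_nonneg.2 h2) (sub_nonneg.2 (hr1 i))]
  have := Finset.sum_le_sum fun i (_ : i ∈ Finset.univ) => hterm i
  simp only [Finset.sum_add_distrib] at this
  have hsum' : ∑ i, l i = 1 := hsum
  linarith

theorem Matrix.IsHermitian.star_eigenvectorUnitary_mul_mul_apply_self {m : Type*} [Fintype m]
    [DecidableEq m] {ρ : Matrix m m ℂ} (h : ρ.IsHermitian) (i : m) :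
    (star (h.eigenvectorUnitary : Matrix m m ℂ) * ρ * h.eigenvectorUnitary) i i
      = (h.eigenvalues i : ℂ) := by
  have := h.conjStarAlgAut_star_eigenvectorUnitary
  rw [Unitary.conjStarAlgAut_star_apply] at this
  rw [this, Matrix.diagonal_apply_eq]
  rfl

open scoped Kronecker in
/-- Subadditivity of `F_q` for bipartite states. -/
theorem traceRpow_add_le {B C : Type*} [Fintype B] [DecidableEq B] [Fintype C] [DecidableEq C]
    {q : ℝ} (hq : 1 ≤ q) {σ : Matrix (B × C) (B × C) ℂ} (hσ : σ.PosSemidef) (htr : σ.trace = 1)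
    {σB : Matrix B B ℂ} (hσB : ∀ b b', σB b b' = ∑ c, σ (b, c) (b', c))
    {σC : Matrix C C ℂ} (hσC : ∀ c c', σC c c' = ∑ b, σ (b, c) (b, c'))
    (hB : σB.IsHermitian) (hC : σC.IsHermitian) :
    traceRpow σB hB q + traceRpow σC hC q ≤ 1 + traceRpow σ hσ.1 q := by
  set U := hB.eigenvectorUnitary with hU
  set V := hC.eigenvectorUnitary with hV
  let W : Matrix.unitaryGroup (B × C) ℂ :=
    ⟨(U : Matrix B B ℂ) ⊗ₖ (V : Matrix C C ℂ), Matrix.kronecker_mem_unitary U.2 V.2⟩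
  set τ := star (W : Matrix (B × C) (B × C) ℂ) * σ * W with hτ
  have hτ0 : τ.PosSemidef := hσ.conjTranspose_mul_mul_same _
  have hUU (b b' : B) : ∑ i, U.1 b i * star (U.1 b' i) = if b = b' then 1 else 0 := by
    have := congrFun₂ (Matrix.mem_unitaryGroup_iff.1 U.2) b b'
    simpa only [Matrix.mul_apply, Matrix.star_apply, Matrix.one_apply] using this
  have hVV (b b' : C) : ∑ i, V.1 b i * star (V.1 b' i) = if b = b' then 1 else 0 := by
    have := congrFun₂ (Matrix.mem_unitaryGroup_iff.1 V.2) b b'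
    simpa only [Matrix.mul_apply, Matrix.star_apply, Matrix.one_apply] using this
  have hrow (i : B) : ∑ j, τ (i, j) (i, j) = (hB.eigenvalues i : ℂ) := by
    have happ (j : C) : τ (i, j) (i, j) = ∑ b', ∑ c', ∑ b, ∑ c,
        star (U.1 b i) * σ (b, c) (b', c') * U.1 b' i * (V.1 c' j * star (V.1 c j)) := by
      simp only [hτ, W, Matrix.mul_apply, Fintype.sum_prod_type, Matrix.star_apply,
        Matrix.kroneckerMap_apply, Finset.sum_mul, star_mul']
      refine Finset.sum_congr rfl fun _ _ => Finset.sum_congr rfl fun _ _ =>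
        Finset.sum_congr rfl fun _ _ => Finset.sum_congr rfl fun _ _ => by ring
    rw [← hB.star_eigenvectorUnitary_mul_mul_apply_self, ← hU]
    simp only [happ, Matrix.mul_apply, Matrix.star_apply, hσB]
    rw [Finset.sum_comm]
    refine Finset.sum_congr rfl fun b' _ => ?_
    simp only [Finset.mul_sum, Finset.sum_mul]
    rw [Finset.sum_comm, Finset.sum_comm (s := Finset.univ (α := B))]
    refine Finset.sum_congr rfl fun c' _ => ?_
    rw [Finset.sum_comm]
    refine Finset.sum_congr rfl fun b _ => ?_
    rw [Finset.sum_comm]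
    simp only [← Finset.mul_sum, hVV, mul_ite, mul_one, mul_zero, Finset.sum_ite_eq,
      Finset.mem_univ, if_true]
  have hcol (j : C) : ∑ i, τ (i, j) (i, j) = (hC.eigenvalues j : ℂ) := by
    have happ (i : B) : τ (i, j) (i, j) = ∑ c', ∑ b', ∑ c, ∑ b,
        star (V.1 c j) * σ (b, c) (b', c') * V.1 c' j * (U.1 b' i * star (U.1 b i)) := by
      simp only [hτ, W, Matrix.mul_apply, Fintype.sum_prod_type_right, Matrix.star_apply,
        Matrix.kroneckerMap_apply, Finset.sum_mul, star_mul']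
      refine Finset.sum_congr rfl fun _ _ => Finset.sum_congr rfl fun _ _ =>
        Finset.sum_congr rfl fun _ _ => Finset.sum_congr rfl fun _ _ => by ring
    rw [← hC.star_eigenvectorUnitary_mul_mul_apply_self, ← hV]
    simp only [happ, Matrix.mul_apply, Matrix.star_apply, hσC]
    rw [Finset.sum_comm]
    refine Finset.sum_congr rfl fun c' _ => ?_
    simp only [Finset.mul_sum, Finset.sum_mul]
    rw [Finset.sum_comm, Finset.sum_comm (s := Finset.univ (α := C))]
    refine Finset.sum_congr rfl fun b' _ => ?_
    rw [Finset.sum_comm]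
    refine Finset.sum_congr rfl fun c _ => ?_
    rw [Finset.sum_comm]
    simp only [← Finset.mul_sum, hUU, mul_ite, mul_one, mul_zero, Finset.sum_ite_eq,
      Finset.mem_univ, if_true]
  have hre (i : B) : ∑ j, (τ (i, j) (i, j)).re = hB.eigenvalues i := by
    rw [← Complex.re_sum, hrow, Complex.ofReal_re]
  have hre' (j : C) : ∑ i, (τ (i, j) (i, j)).re = hC.eigenvalues j := by
    rw [← Complex.re_sum, hcol, Complex.ofReal_re]
  have hsum : ∑ i, ∑ j, (τ (i, j) (i, j)).re = 1 := by
    have : τ.trace = 1 := by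
      rw [hτ, Matrix.trace_mul_cycle, Matrix.mem_unitaryGroup_iff.1 W.2, one_mul, htr]
    rw [Matrix.trace, Fintype.sum_prod_type] at this
    simpa using congrArg Complex.re this
  have hclass := sum_marginal_rpow_le
    (fun i j => (Complex.le_def.1 (hτ0.diag_nonneg (i := (i, j)))).1) hsum hq
  have hpeierls := sum_diag_rpow_le_traceRpow hσ W hq
  rw [Fintype.sum_prod_type] at hpeierls
  simp only [hre, hre'] at hclass
  exact hclass.trans (add_le_add_right hpeierls 1)

open Matrix in
/-- Araki–Lieb type inequality, from subadditivity applied to a purification. -/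
theorem traceRpow_add_le_one_add {A B : Type*} [Fintype A] [DecidableEq A] [Fintype B]
    [DecidableEq B] {q : ℝ} (hq : 1 ≤ q) {ρ : Matrix (A × B) (A × B) ℂ} (hρ : ρ.PosSemidef)
    (htr : ρ.trace = 1)
    {ρA : Matrix A A ℂ} (hρA : ∀ a a', ρA a a' = ∑ b, ρ (a, b) (a', b))
    {ρB : Matrix B B ℂ} (hρB : ∀ b b', ρB b b' = ∑ a, ρ (a, b) (a, b'))
    (hA : ρA.IsHermitian) (hB : ρB.IsHermitian) :
    traceRpow ρ hρ.1 q + traceRpow ρB hB q ≤ 1 + traceRpow ρA hA q := by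
  have hq0 : q ≠ 0 := by positivity
  obtain ⟨M, hM⟩ : ∃ M : Matrix (A × B) (A × B) ℂ, ρ = M * Mᴴ := by
    open scoped MatrixOrder in
    obtain ⟨N, hN⟩ := CStarAlgebra.nonneg_iff_eq_star_mul_self.mp hρ.nonneg
    exact ⟨Nᴴ, by rw [hN, conjTranspose_conjTranspose, star_eq_conjTranspose]⟩
  let N : Matrix (B × (A × B)) A ℂ := Matrix.of fun x a => M (a, x.1) x.2
  have hN : (N * Nᴴ).PosSemidef := posSemidef_self_mul_conjTranspose N
  have hNA : Nᴴ * N = ρAᵀ := by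
    ext a a'
    simp only [hρA, hM, mul_apply, transpose_apply, conjTranspose_apply, N, of_apply,
      Fintype.sum_prod_type, mul_comm]
  have hNtr : (N * Nᴴ).trace = 1 := by
    rw [trace_mul_comm, hNA, trace_transpose, ← htr]
    simp only [Matrix.trace, diag_apply, hρA, Fintype.sum_prod_type]
  have hMM : (Mᴴ * M)ᵀ.IsHermitian := (isHermitian_conjTranspose_mul_self M).transpose
  have hsub := traceRpow_add_le hq hN hNtr (σB := ρB) (σC := (Mᴴ * M)ᵀ)
    (fun b b' => by
      simp only [hρB, hM, mul_apply, conjTranspose_apply, N, of_apply]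
      exact Finset.sum_comm)
    (fun c c' => by
      simp only [mul_apply, transpose_apply, conjTranspose_apply, N, of_apply,
        Fintype.sum_prod_type, mul_comm]
      exact Finset.sum_comm) hB hMM
  have h1 : traceRpow (Mᴴ * M)ᵀ hMM q = traceRpow ρ hρ.1 q :=
    traceRpow_eq_of_charpoly_eq _ _ (by rw [charpoly_transpose, charpoly_mul_comm, hM]) q
  have h2 : traceRpow (N * Nᴴ) hN.1 q = traceRpow ρA hA q := by
    rw [traceRpow_mul_comm _ _ _ (isHermitian_conjTranspose_mul_self N) hq0]
    exact traceRpow_eq_of_charpoly_eq _ _ (by rw [hNA, charpoly_transpose]) q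
  linarith

theorem stmt3 {A B : Type*} [Fintype A] [DecidableEq A] [Fintype B] [DecidableEq B]
    (q : ℝ) (hq : 2 ≤ q)
    (ρAB : Matrix (A × B) (A × B) ℂ) (hρ : ρAB.PosSemidef) (htr : ρAB.trace = 1)
    (ρA : Matrix A A ℂ) (hρA : ∀ a a', ρA a a' = ∑ b, ρAB (a, b) (a', b))
    (ρB : Matrix B B ℂ) (hρB : ∀ b b', ρB b b' = ∑ a, ρAB (a, b) (a, b'))
    (hA : ρA.IsHermitian) (hB : ρB.IsHermitian) :
    |FqEnt ρA hA q - FqEnt ρB hB q| ≤ FqEnt ρAB hρ.1 q := by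
  have hAB := traceRpow_add_le_one_add (by linarith) hρ htr hρA hρB hA hB
  let e : A × B ≃ B × A := Equiv.prodComm A B
  have hρ' : (Matrix.reindex e e ρAB).PosSemidef := hρ.submatrix e.symm
  have htr' : (Matrix.reindex e e ρAB).trace = 1 := by
    rw [← htr, Matrix.trace, Matrix.trace, ← e.sum_comp]
    simp
  have hBA := traceRpow_add_le_one_add (by linarith : 1 ≤ q) hρ' htr' hρB hρA hB hA
  rw [traceRpow_eq_of_charpoly_eq hρ'.1 hρ.1 (Matrix.charpoly_reindex e ρAB) q] at hBA
  unfold FqEnt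
  rw [abs_le]
  constructor <;> linarith
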